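/- Let F ∈ ℤ[t] be an irreducible polynomial of degree g ≥ 2. There exist constants D ≥ 2 and K > 0, depending only on F, such that for every real η > 0 and every real z ≥ D: ∑_{ℓ} L(ℓ; η) ρ(ℓ)/φ_F(ℓ) ≤ K · ∑_{a ∈ 𝒫(D, z)} L(a; η) ρ(a)/φ_F(a), where the left-hand sum runs over all positive integers ℓ (not necessarily squarefree) with P⁻(ℓ) > D and P⁺(ℓ) ≤ z. -/

import Mathlib

open Real MeasureTheory
open scoped Classical

/-- number of residues n mod d with F(n) ≡ 0 (mod d) -/
noncomputable def polyRho (F : Polynomial ℤ) (d : ℕ) : ℕ :=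
  ((Finset.range d).filter (fun n => (d : ℤ) ∣ F.eval (n : ℤ))).card

/-- H_F(x,y,z): number of positive n ≤ x with F(n) having a divisor in (y,z] -/
noncomputable def polyH (F : Polynomial ℤ) (x y z : ℝ) : ℕ :=
  {n : ℕ | 0 < n ∧ (n : ℝ) ≤ x ∧
    ∃ d : ℕ, 0 < d ∧ (d : ℤ) ∣ F.eval (n : ℤ) ∧ y < (d : ℝ) ∧ (d : ℝ) ≤ z}.ncard

/-- H(x,y,z): number of positive n ≤ x having a divisor in (y,z] -/
noncomputable def Hdiv (x y z : ℝ) : ℕ :=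
  {n : ℕ | 0 < n ∧ (n : ℝ) ≤ x ∧
    ∃ d : ℕ, 0 < d ∧ d ∣ n ∧ y < (d : ℝ) ∧ (d : ℝ) ≤ z}.ncard

/-- L(a;σ) -/
noncomputable def Lfun (a : ℕ) (σ : ℝ) : ℝ :=
  (volume {x : ℝ | ∃ d : ℕ, d ∣ a ∧ Real.exp x < (d : ℝ) ∧ (d : ℝ) ≤ Real.exp (x + σ)}).toReal

/-- W(a;σ): ordered pairs of divisors near each other -/
noncomputable def Wfun (a : ℕ) (σ : ℝ) : ℕ :=
  {p : ℕ × ℕ | p.1 ∣ a ∧ p.2 ∣ a ∧ |Real.log ((p.1 : ℝ) / (p.2 : ℝ))| ≤ σ}.ncard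

/-- 𝒫(s,t): squarefree integers with all prime factors in (s,t] -/
def Psf (s t : ℝ) : Set ℕ :=
  {a : ℕ | 0 < a ∧ Squarefree a ∧ ∀ p : ℕ, p.Prime → p ∣ a → s < (p : ℝ) ∧ (p : ℝ) ≤ t}

/-- φ_F(n) = n ∏_{p|n} (1 - ρ(p)/p) -/
noncomputable def polyPhi (F : Polynomial ℤ) (n : ℕ) : ℝ :=
  (n : ℝ) * ∏ p ∈ n.primeFactors, (1 - (polyRho F p : ℝ) / p)

/-- P⁺(n): largest prime factor, P⁺(1)=0 -/
def Pplus (n : ℕ) : ℕ := n.primeFactors.sup id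

/-- h(n;X): least prime q with ∏_{p^ν ∥ n, p ≤ q} p^ν > √X -/
noncomputable def hfun (n : ℕ) (X : ℝ) : ℕ :=
  sInf {q : ℕ | q.Prime ∧
    Real.sqrt X < ∏ p ∈ n.primeFactors.filter (fun p => p ≤ q), (p : ℝ) ^ (n.factorization p)}
theorem exists_bezout_int_of_irreducible {F : Polynomial ℤ} (hF : Irreducible F)
    (hdeg : F.natDegree ≠ 0) :
    ∃ (N : ℤ) (u v : Polynomial ℤ), N ≠ 0 ∧
      u * F + v * Polynomial.derivative F = Polynomial.C N := by
  have hirr : Irreducible (F.map (Int.castRingHom ℚ)) :=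
    (Polynomial.IsPrimitive.Int.irreducible_iff_irreducible_map_cast
      (hF.isPrimitive hdeg)).1 hF
  obtain ⟨a, b, hab⟩ := hirr.separable
  obtain ⟨r, hr, hra⟩ := IsLocalization.integerNormalization_spec (nonZeroDivisors ℤ) a
  obtain ⟨s, hs, hsb⟩ := IsLocalization.integerNormalization_spec (nonZeroDivisors ℤ) b
  set A := IsLocalization.integerNormalization (nonZeroDivisors ℤ) a
  set B := IsLocalization.integerNormalization (nonZeroDivisors ℤ) b
  refine ⟨r * s, Polynomial.C s * A, Polynomial.C r * B,
    mul_ne_zero (nonZeroDivisors.ne_zero hr) (nonZeroDivisors.ne_zero hs), ?_⟩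
  apply Polynomial.map_injective (Int.castRingHom ℚ) Int.cast_injective
  have hra' : A.map (Int.castRingHom ℚ) = Polynomial.C (r : ℚ) * a := by
    rw [← Polynomial.smul_eq_C_mul, Int.cast_smul_eq_zsmul]; exact hra
  have hsb' : B.map (Int.castRingHom ℚ) = Polynomial.C (s : ℚ) * b := by
    rw [← Polynomial.smul_eq_C_mul, Int.cast_smul_eq_zsmul]; exact hsb
  rw [Polynomial.derivative_map] at hab
  simp only [Polynomial.map_add, Polynomial.map_mul, hra', hsb', eq_intCast,
    Int.cast_mul]
  rw [← eq_intCast Polynomial.C s, ← eq_intCast Polynomial.C r, Polynomial.map_C, Polynomial.map_C,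
    eq_intCast, eq_intCast]
  linear_combination (Polynomial.C (r : ℚ) * Polynomial.C (s : ℚ)) * hab

theorem polyRho_eq_card_filter_range (F : Polynomial ℤ) (d : ℕ) :
    polyRho F d = ((Finset.range d).filter fun n : ℕ => (d : ℤ) ∣ F.eval (n : ℤ)).card := by
  unfold polyRho
  have h : (do let a ← Finset.range d; pure (a : ℤ) : Finset ℤ) =
      (Finset.range d).map Nat.castEmbedding := by
    ext x
    simp
  rw [h, Finset.filter_map, Finset.card_map]
  rfl

theorem polyRho_prime_le_natDegree (F : Polynomial ℤ) {p : ℕ} (hp : p.Prime)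
    (hlc : ¬ (p : ℤ) ∣ F.leadingCoeff) : polyRho F p ≤ F.natDegree := by
  have := Fact.mk hp
  have hne : F.map (Int.castRingHom (ZMod p)) ≠ 0 := by
    intro h
    apply hlc
    have := congrArg (fun G => Polynomial.coeff G F.natDegree) h
    simpa [ZMod.intCast_zmod_eq_zero_iff_dvd, Polynomial.coeff_map] using this
  calc polyRho F p ≤ (F.map (Int.castRingHom (ZMod p))).roots.toFinset.card := by
        rw [polyRho_eq_card_filter_range]
        refine Finset.card_le_card_of_injOn (fun n : ℕ => (n : ZMod p)) ?_ ?_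
        · intro n hn
          simp only [Finset.coe_filter, Set.mem_ofPred_eq] at hn
          simp only [Finset.mem_coe, Multiset.mem_toFinset, Polynomial.mem_roots hne,
            Polynomial.IsRoot.def]
          have h := (ZMod.intCast_zmod_eq_zero_iff_dvd (F.eval (n : ℤ)) p).2 hn.2
          rw [← Int.cast_natCast (R := ZMod p) n, ← eq_intCast (Int.castRingHom (ZMod p)) (n : ℤ),
            Polynomial.eval_map_apply]
          exact h
        · intro x hx y hy hxy
          simp only [Finset.coe_filter, Set.mem_ofPred_eq, Finset.mem_range] at hx hy
          have := (ZMod.natCast_eq_natCast_iff' x y p).1 hxy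
          rwa [Nat.mod_eq_of_lt hx.1, Nat.mod_eq_of_lt hy.1] at this
    _ ≤ _ := (Multiset.toFinset_card_le _).trans
        ((Polynomial.card_roots' _).trans (Polynomial.natDegree_map_le))

theorem polyRho_le_self (F : Polynomial ℤ) (n : ℕ) : polyRho F n ≤ n := by
  rw [polyRho_eq_card_filter_range]
  simpa using Finset.card_filter_le (Finset.range n) (fun k => (n : ℤ) ∣ F.eval (k : ℤ))

/-- At a prime where all roots of `F` are simple, a root modulo `p ^ 2 * n` is determined by its
reductions modulo `n` and modulo `p`. -/
theorem polyRho_sq_mul_le (F : Polynomial ℤ) {p n : ℕ} (hp : p.Prime) (hn : 0 < n)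
    (hsimple : ∀ x : ℤ, (p : ℤ) ∣ F.eval x → ¬ (p : ℤ) ∣ (Polynomial.derivative F).eval x) :
    polyRho F (p ^ 2 * n) ≤ polyRho F n * polyRho F p := by
  simp only [polyRho_eq_card_filter_range]
  rw [← Finset.card_product]
  have hred : ∀ {m x : ℕ}, 0 < m → (m : ℤ) ∣ p ^ 2 * n →
      (((p ^ 2 * n : ℕ) : ℤ) ∣ F.eval (x : ℤ)) →
      x % m < m ∧ (m : ℤ) ∣ F.eval ((x % m : ℕ) : ℤ) := by
    intro m x hm hdvd hx
    refine ⟨Nat.mod_lt _ hm, ?_⟩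
    have h1 : ((x % m : ℕ) : ℤ) - x ∣ F.eval ((x % m : ℕ) : ℤ) - F.eval (x : ℤ) :=
      Polynomial.sub_dvd_eval_sub _ _ _
    have h2 : (m : ℤ) ∣ ((x % m : ℕ) : ℤ) - x := by
      push_cast
      exact (Int.mod_modEq x m).symm.dvd
    have h3 : (m : ℤ) ∣ F.eval (x : ℤ) := hdvd.trans (by exact_mod_cast hx)
    exact (dvd_sub_left h3).1 (h2.trans h1)
  refine Finset.card_le_card_of_injOn (fun x => (x % n, x % p)) ?_ ?_
  · intro x hx
    simp only [Finset.coe_filter, Set.mem_ofPred_eq] at hx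
    simp only [Finset.coe_product, Set.mem_prod, Finset.mem_coe, Finset.mem_filter,
      Finset.mem_range]
    exact ⟨hred hn (dvd_mul_left _ _) hx.2,
      hred hp.pos (dvd_mul_of_dvd_left (dvd_pow_self _ two_ne_zero) _) hx.2⟩
  · intro x hx y hy hxy
    simp only [Finset.coe_filter, Set.mem_ofPred_eq, Finset.mem_range] at hx hy
    simp only [Prod.mk.injEq] at hxy
    obtain ⟨e, he⟩ : (n : ℤ) ∣ (x : ℤ) - y :=
      (Nat.modEq_iff_dvd (n := n)).1 (show y ≡ x [MOD n] from hxy.1.symm)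
    have hpd : (p : ℤ) ∣ (x : ℤ) - y :=
      (Nat.modEq_iff_dvd (n := p)).1 (show y ≡ x [MOD p] from hxy.2.symm)
    obtain ⟨k, hk⟩ := Polynomial.binomExpansion F (y : ℤ) ((x : ℤ) - y)
    rw [add_sub_cancel] at hk
    set c := (Polynomial.derivative F).eval (y : ℤ) + k * ((x : ℤ) - y) with hc
    have hpy : (p : ℤ) ∣ F.eval (y : ℤ) := by
      refine dvd_trans ?_ hy.2
      push_cast
      exact dvd_mul_of_dvd_left (dvd_pow_self _ two_ne_zero) _
    have hpc : ¬ (p : ℤ) ∣ c := fun h =>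
      hsimple y hpy ((dvd_add_left (dvd_mul_of_dvd_right hpd k)).1 h)
    have hcop : IsCoprime ((p : ℤ) ^ 2) c :=
      ((Nat.prime_iff_prime_int.1 hp).coprime_iff_not_dvd.2 hpc).pow_left
    have hmul : (n : ℤ) * (p : ℤ) ^ 2 ∣ n * (e * c) := by
      have h := dvd_sub hx.2 hy.2
      have h2 : F.eval (x : ℤ) - F.eval (y : ℤ) = n * (e * c) := by
        rw [hk, hc]
        linear_combination ((Polynomial.derivative F).eval (y : ℤ) + k * ((x : ℤ) - y)) * he
      rw [h2] at h
      push_cast at h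
      rwa [mul_comm ((p : ℤ) ^ 2)] at h
    have hpe : (p : ℤ) ^ 2 ∣ e :=
      hcop.dvd_of_dvd_mul_right ((mul_dvd_mul_iff_left (by exact_mod_cast hn.ne')).1 hmul)
    have hfin : ((p ^ 2 * n : ℕ) : ℤ) ∣ (x : ℤ) - y := by
      rw [he, mul_comm (n : ℤ)]
      push_cast
      exact mul_dvd_mul_right hpe _
    have := ((Nat.modEq_iff_dvd (n := p ^ 2 * n)).2 hfin).symm
    rwa [Nat.ModEq, Nat.mod_eq_of_lt hx.1, Nat.mod_eq_of_lt hy.1] at this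

theorem polyPhi_nonneg (F : Polynomial ℤ) (n : ℕ) : 0 ≤ polyPhi F n := by
  refine mul_nonneg n.cast_nonneg (Finset.prod_nonneg fun p hp => sub_nonneg.2 ?_)
  have hp' : (0 : ℝ) < p := by exact_mod_cast (Nat.prime_of_mem_primeFactors hp).pos
  rw [div_le_one hp']
  exact_mod_cast polyRho_le_self F p

theorem polyPhi_pos (F : Polynomial ℤ) {n : ℕ} (hn : 0 < n)
    (h : ∀ p : ℕ, p.Prime → p ∣ n → polyRho F p < p) : 0 < polyPhi F n := by
  refine mul_pos (by exact_mod_cast hn) (Finset.prod_pos fun p hp => sub_pos.2 ?_)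
  have hpp := Nat.prime_of_mem_primeFactors hp
  have hp' : (0 : ℝ) < p := by exact_mod_cast hpp.pos
  rw [div_lt_one hp']
  exact_mod_cast h p hpp (Nat.dvd_of_mem_primeFactors hp)

theorem le_polyPhi_sq_mul (F : Polynomial ℤ) {p n : ℕ} (hp : p.Prime) (hn : 0 < n)
    (hρ : 2 * polyRho F p ≤ p) :
    (p : ℝ) ^ 2 * polyPhi F n / 2 ≤ polyPhi F (p ^ 2 * n) := by
  have hp' : (0 : ℝ) < p := by exact_mod_cast hp.pos
  have hfac : (p ^ 2 * n).primeFactors = insert p n.primeFactors := by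
    rw [Nat.primeFactors_mul (pow_ne_zero _ hp.ne_zero) hn.ne',
      Nat.primeFactors_prime_pow two_ne_zero hp, Finset.insert_eq]
  have h0 : 0 ≤ (p : ℝ) ^ 2 * polyPhi F n := mul_nonneg (by positivity) (polyPhi_nonneg F n)
  by_cases hpn : p ∈ n.primeFactors
  · have : polyPhi F (p ^ 2 * n) = (p : ℝ) ^ 2 * polyPhi F n := by
      rw [polyPhi, polyPhi, hfac, Finset.insert_eq_of_mem hpn]
      push_cast
      ring
    linarith
  · have : polyPhi F (p ^ 2 * n) =
        (p : ℝ) ^ 2 * polyPhi F n * (1 - (polyRho F p : ℝ) / p) := by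
      rw [polyPhi, polyPhi, hfac, Finset.prod_insert hpn]
      push_cast
      ring
    rw [this, div_eq_mul_inv]
    refine mul_le_mul_of_nonneg_left ?_ h0
    have : (polyRho F p : ℝ) / p ≤ 1 / 2 := by
      rw [div_le_div_iff₀ hp' two_pos, one_mul, mul_comm]
      exact_mod_cast hρ
    linarith

theorem Lfun_nonneg (a : ℕ) (σ : ℝ) : 0 ≤ Lfun a σ := ENNReal.toReal_nonneg

theorem volume_near_divisor_lt_top {a : ℕ} (ha : 0 < a) (σ : ℝ) :
    volume {x : ℝ | ∃ d : ℕ, d ∣ a ∧ Real.exp x < (d : ℝ) ∧ (d : ℝ) ≤ Real.exp (x + σ)} < ⊤ := by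
  refine (measure_mono (t := Set.Icc (-σ) (Real.log a)) ?_).trans_lt measure_Icc_lt_top
  rintro x ⟨d, hd, h1, h2⟩
  have hd0 : 0 < d := Nat.pos_of_dvd_of_pos hd ha
  have hd1 : (1 : ℝ) ≤ d := by exact_mod_cast hd0
  constructor
  · have : 0 ≤ x + σ := Real.one_le_exp_iff.1 (hd1.trans h2)
    linarith
  · rw [Real.le_log_iff_exp_le (by exact_mod_cast ha)]
    exact h1.le.trans (by exact_mod_cast Nat.le_of_dvd ha hd)

theorem Lfun_prime_mul_le {p a : ℕ} (hp : p.Prime) (ha : 0 < a) (σ : ℝ) :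
    Lfun (p * a) σ ≤ 2 * Lfun a σ := by
  have hp' : (0 : ℝ) < p := by exact_mod_cast hp.pos
  set S : Set ℝ :=
    {x : ℝ | ∃ d : ℕ, d ∣ a ∧ Real.exp x < (d : ℝ) ∧ (d : ℝ) ≤ Real.exp (x + σ)} with hS
  have hsub : {x : ℝ | ∃ d : ℕ, d ∣ p * a ∧ Real.exp x < (d : ℝ) ∧
      (d : ℝ) ≤ Real.exp (x + σ)} ⊆ S ∪ (fun x => -Real.log p + x) ⁻¹' S := by
    rintro x ⟨d, hd, h1, h2⟩
    by_cases hpd : p ∣ d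
    · right
      obtain ⟨e, rfl⟩ := hpd
      refine ⟨e, Nat.dvd_of_mul_dvd_mul_left hp.pos hd, ?_, ?_⟩
      · rw [Real.exp_add, Real.exp_neg, Real.exp_log hp', inv_mul_lt_iff₀ hp']
        exact_mod_cast h1
      · rw [add_assoc, Real.exp_add, Real.exp_neg, Real.exp_log hp', le_inv_mul_iff₀ hp']
        exact_mod_cast h2
    · left
      exact ⟨d, ((Nat.Prime.coprime_iff_not_dvd hp).2 hpd).symm.dvd_of_dvd_mul_left hd, h1, h2⟩
  have hlt := volume_near_divisor_lt_top ha σ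
  have hle := (measure_mono hsub).trans (measure_union_le (μ := volume) _ _)
  rw [measure_preimage_add, ← two_mul] at hle
  have := ENNReal.toReal_mono (ENNReal.mul_ne_top ENNReal.ofNat_ne_top hlt.ne) hle
  rwa [ENNReal.toReal_mul, ENNReal.toReal_ofNat] at this

theorem weight_nonneg (F : Polynomial ℤ) (η : ℝ) (n : ℕ) :
    0 ≤ Lfun n η * (polyRho F n : ℝ) / polyPhi F n :=
  div_nonneg (mul_nonneg (Lfun_nonneg _ _) (Nat.cast_nonneg _)) (polyPhi_nonneg _ _)

theorem weight_prime_sq_mul_le (F : Polynomial ℤ) (η : ℝ) {p n g : ℕ} (hp : p.Prime) (hn : 0 < n)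
    (hsimple : ∀ x : ℤ, (p : ℤ) ∣ F.eval x → ¬ (p : ℤ) ∣ (Polynomial.derivative F).eval x)
    (hρ : polyRho F p ≤ g) (hg : (8 * g) ^ 2 ≤ p) (hφ : 0 < polyPhi F n) :
    Lfun (p ^ 2 * n) η * (polyRho F (p ^ 2 * n) : ℝ) / polyPhi F (p ^ 2 * n) ≤
      (p : ℝ) ^ (-(3 / 2) : ℝ) * (Lfun n η * (polyRho F n : ℝ) / polyPhi F n) := by
  have hp' : (0 : ℝ) < p := by exact_mod_cast hp.pos
  have hL : Lfun (p ^ 2 * n) η ≤ 4 * Lfun n η := by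
    have h1 := Lfun_prime_mul_le hp (Nat.mul_pos hp.pos hn) η
    have h2 := Lfun_prime_mul_le hp hn η
    rw [pow_two, mul_assoc]
    linarith
  have hR : (polyRho F (p ^ 2 * n) : ℝ) ≤ g * polyRho F n := by
    have := (polyRho_sq_mul_le F hp hn hsimple).trans (Nat.mul_le_mul_left _ hρ)
    rw [mul_comm (g : ℝ)]
    exact_mod_cast this
  have hP := le_polyPhi_sq_mul F hp hn (by nlinarith : 2 * polyRho F p ≤ p)
  have hsqrt : (8 * g : ℝ) ≤ (p : ℝ) ^ (1 / 2 : ℝ) := by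
    rw [← Real.sqrt_eq_rpow]
    exact Real.le_sqrt_of_sq_le (by exact_mod_cast hg)
  have hpow : (p : ℝ) ^ (-(3 / 2) : ℝ) = (p : ℝ) ^ (1 / 2 : ℝ) / (p : ℝ) ^ 2 := by
    rw [← Real.rpow_natCast, ← Real.rpow_sub hp']
    norm_num
  have hL0 := Lfun_nonneg n η
  calc _ ≤ (4 * Lfun n η) * (g * polyRho F n) / ((p : ℝ) ^ 2 * polyPhi F n / 2) := by
        gcongr
    _ = (8 * g) / (p : ℝ) ^ 2 * (Lfun n η * (polyRho F n : ℝ) / polyPhi F n) := by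
        field_simp
        ring
    _ ≤ _ := by
        rw [hpow]
        gcongr

theorem weight_sq_mul_le (F : Polynomial ℤ) (η : ℝ) {D g a : ℕ}
    (hsimple : ∀ p : ℕ, p.Prime → D < p → ∀ x : ℤ, (p : ℤ) ∣ F.eval x →
      ¬ (p : ℤ) ∣ (Polynomial.derivative F).eval x)
    (hρ : ∀ p : ℕ, p.Prime → D < p → polyRho F p ≤ g)
    (hlt : ∀ p : ℕ, p.Prime → D < p → polyRho F p < p)
    (hg : (8 * g) ^ 2 ≤ D) (ha : 0 < a) (m : ℕ) (hm : 0 < m)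
    (hD : ∀ p : ℕ, p.Prime → p ∣ m ^ 2 * a → D < p) :
    Lfun (m ^ 2 * a) η * (polyRho F (m ^ 2 * a) : ℝ) / polyPhi F (m ^ 2 * a) ≤
      (m : ℝ) ^ (-(3 / 2) : ℝ) * (Lfun a η * (polyRho F a : ℝ) / polyPhi F a) := by
  induction m using induction_on_primes with
  | zero => exact absurd hm (lt_irrefl _)
  | one => simp
  | prime_mul p k hp ih =>
    have hk : 0 < k := Nat.pos_of_mul_pos_left hm
    have hka : 0 < k ^ 2 * a := by positivity
    have heq : (p * k) ^ 2 * a = p ^ 2 * (k ^ 2 * a) := by ring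
    rw [heq] at hD ⊢
    have hDk : ∀ q : ℕ, q.Prime → q ∣ k ^ 2 * a → D < q :=
      fun q hq hqk => hD q hq (dvd_mul_of_dvd_right hqk _)
    have hDp : D < p := hD p hp (dvd_mul_of_dvd_left (dvd_pow_self _ two_ne_zero) _)
    refine (weight_prime_sq_mul_le F η hp hka (hsimple p hp hDp) (hρ p hp hDp)
      (hg.trans hDp.le) (polyPhi_pos F hka fun q hq hqk => hlt q hq (hDk q hq hqk))).trans ?_
    rw [Nat.cast_mul, Real.mul_rpow (Nat.cast_nonneg _) (Nat.cast_nonneg _), mul_assoc]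
    gcongr
    exact ih hk hDk

theorem finite_Psf (s t : ℝ) : (Psf s t).Finite := by
  refine (((Finset.range (⌊t⌋₊ + 1)).powerset.image fun A => ∏ p ∈ A, p).finite_toSet).subset ?_
  rintro a ⟨ha, hsq, hp⟩
  simp only [Finset.coe_image, Set.mem_image, Finset.mem_coe, Finset.mem_powerset]
  refine ⟨a.primeFactors, fun p hpa => ?_, Nat.prod_primeFactors_of_squarefree hsq⟩
  have := (hp p (Nat.prime_of_mem_primeFactors hpa) (Nat.dvd_of_mem_primeFactors hpa)).2
  exact Finset.mem_range.2 (Nat.lt_succ_of_le (Nat.le_floor this))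

theorem exists_threshold {F : Polynomial ℤ} (hF : Irreducible F) (hdeg : F.natDegree ≠ 0) :
    ∃ D : ℕ, 2 ≤ D ∧ (8 * F.natDegree) ^ 2 ≤ D ∧ ∀ p : ℕ, p.Prime → D < p →
      polyRho F p ≤ F.natDegree ∧
      ∀ x : ℤ, (p : ℤ) ∣ F.eval x → ¬ (p : ℤ) ∣ (Polynomial.derivative F).eval x := by
  obtain ⟨N, u, v, hN, huv⟩ := exists_bezout_int_of_irreducible hF hdeg
  have hnd : ∀ {p : ℕ} {c : ℤ}, c ≠ 0 → c.natAbs < p → ¬ (p : ℤ) ∣ c := by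
    intro p c hc hlt hdvd
    have := Nat.le_of_dvd (Int.natAbs_pos.2 hc) (Int.natCast_dvd.1 hdvd)
    omega
  refine ⟨(8 * F.natDegree) ^ 2 + N.natAbs + F.leadingCoeff.natAbs + 2, by omega, by omega,
    fun p hp hDp => ⟨polyRho_prime_le_natDegree F hp
      (hnd (Polynomial.leadingCoeff_ne_zero.2 hF.ne_zero) (by omega)), fun x h1 h2 => ?_⟩⟩
  apply hnd hN (by omega : N.natAbs < p)
  have h := congrArg (Polynomial.eval x) huv
  simp only [Polynomial.eval_add, Polynomial.eval_mul, Polynomial.eval_C] at h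
  rw [← h]
  exact dvd_add (dvd_mul_of_dvd_right h1 _) (dvd_mul_of_dvd_right h2 _)

theorem stmt17 (F : Polynomial ℤ) (hF : Irreducible F) (hdeg : 2 ≤ F.natDegree) :
    ∃ (D : ℕ) (K : ℝ), 2 ≤ D ∧ 0 < K ∧
      (∀ p : ℕ, p.Prime → D < p → polyRho F p < p) ∧
      ∀ η z : ℝ, 0 < η → (D : ℝ) ≤ z →
        ∑' ℓ : {ℓ : ℕ | 0 < ℓ ∧ (∀ p : ℕ, p.Prime → p ∣ ℓ → D < p) ∧ (Pplus ℓ : ℝ) ≤ z},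
          Lfun ℓ η * (polyRho F ℓ : ℝ) / polyPhi F ℓ ≤
        K * ∑' a : (Psf D z), Lfun a η * (polyRho F a : ℝ) / polyPhi F a := by
  obtain ⟨D, hD2, hDg, hD⟩ := exists_threshold hF (by omega)
  have hlt : ∀ p : ℕ, p.Prime → D < p → polyRho F p < p := by
    intro p hp hDp
    have := (hD p hp hDp).1
    nlinarith
  have hsum : Summable fun m : ℕ => (m : ℝ) ^ (-(3 / 2) : ℝ) :=
    Real.summable_nat_rpow.2 (by norm_num)
  refine ⟨D, ∑' m : ℕ, (m : ℝ) ^ (-(3 / 2) : ℝ), hD2,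
    hsum.tsum_pos (fun m => by positivity) 1 (by simp), hlt, fun η z _ _ => ?_⟩
  have hfin : Finite (Psf D z) := finite_Psf D z
  have hsumA : Summable fun a : Psf D z => Lfun a η * (polyRho F a : ℝ) / polyPhi F a :=
    Summable.of_finite
  have hprod := hsum.mul_of_nonneg hsumA (fun m => by positivity) (fun a => weight_nonneg F η a)
  rw [hsum.tsum_mul_tsum hsumA hprod]
  have hdecomp : ∀ ℓ : {ℓ : ℕ | 0 < ℓ ∧ (∀ p : ℕ, p.Prime → p ∣ ℓ → D < p) ∧ (Pplus ℓ : ℝ) ≤ z},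
      ∃ y : ℕ × Psf D z, 0 < y.1 ∧ y.1 ^ 2 * (y.2 : ℕ) = ℓ := by
    rintro ⟨ℓ, hℓ, hpD, hPz⟩
    obtain ⟨a, b, ha, hb, hab, hsq⟩ := Nat.sq_mul_squarefree_of_pos hℓ
    refine ⟨(b, ⟨a, ha, hsq, fun p hp hpa => ?_⟩), hb, hab⟩
    have hpl : p ∣ ℓ := hab ▸ dvd_mul_of_dvd_right hpa _
    refine ⟨by exact_mod_cast hpD p hp hpl, le_trans ?_ hPz⟩
    exact_mod_cast Finset.le_sup (f := id) (Nat.mem_primeFactors.2 ⟨hp, hpl, hℓ.ne'⟩)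
  choose e he0 he using hdecomp
  have hinj : Function.Injective e := fun x y hxy => Subtype.ext (by rw [← he, ← he, hxy])
  have hle : ∀ ℓ : {ℓ : ℕ | 0 < ℓ ∧ (∀ p : ℕ, p.Prime → p ∣ ℓ → D < p) ∧ (Pplus ℓ : ℝ) ≤ z},
      Lfun ℓ η * (polyRho F ℓ : ℝ) / polyPhi F ℓ ≤ ((e ℓ).1 : ℝ) ^ (-(3 / 2) : ℝ) *
        (Lfun (e ℓ).2 η * (polyRho F (e ℓ).2 : ℝ) / polyPhi F (e ℓ).2) := by
    intro ℓ
    have hpD : ∀ p : ℕ, p.Prime → p ∣ (e ℓ).1 ^ 2 * ((e ℓ).2 : ℕ) → D < p := by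
      rw [he]
      exact ℓ.2.2.1
    have := weight_sq_mul_le F η (fun p hp h => (hD p hp h).2) (fun p hp h => (hD p hp h).1) hlt
      hDg (e ℓ).2.2.1 (e ℓ).1 (he0 ℓ) hpD
    rwa [he] at this
  exact Summable.tsum_le_tsum_of_inj e hinj
    (fun c _ => mul_nonneg (by positivity) (weight_nonneg F η _)) hle
    (Summable.of_nonneg_of_le (fun ℓ => weight_nonneg F η ℓ) hle (hprod.comp_injective hinj)) hprod
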